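/- arXiv:1410.5088 — 2 statements merged into one kernel-verified Lean document; each statement's English description precedes it below -/
import Mathlib

section
/- If a heap H' over P is a subdivision of a heap H over P (obtained by a finite, possibly empty, sequence of single-edge subdivisions), then for all vertices x, y of H: pathLength(H, x, y) = pathLength(H', x, y), and circular(H, x) holds if and only if circular(H', x) holds. -/
/-- A heap over pointer variables `P`: a finite set `V` of vertices (drawn from `ℕ`),
a partial successor function `succ` (with `succ v = none` outside `V`),
an edge-weight function `wt` (weights are at least 1 on actual edges),
and a labelling `L` of pointer variables by vertices. -/
structure Heap (P : Type) where
  V : Finset ℕ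
  succ : ℕ → Option ℕ
  wt : ℕ → ℕ
  L : P → ℕ
  label_mem : ∀ p, L p ∈ V
  succ_mem : ∀ v ∈ V, ∀ u, succ v = some u → u ∈ V
  succ_dom : ∀ v, v ∉ V → succ v = none
  wt_pos : ∀ v ∈ V, succ v ≠ none → 1 ≤ wt v

namespace Heap

variable {P : Type}

/-- `vs` is a walk from `x` to `y`: a nonempty list of vertices starting at `x`,
ending at `y`, where each vertex's successor is the next list element. -/
def IsWalk (H : Heap P) (x y : ℕ) (vs : List ℕ) : Prop :=
  vs.head? = some x ∧ vs.getLast? = some y ∧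
    List.Chain' (fun a b => H.succ a = some b) vs

/-- The weight of a walk: the sum of the weights of its edges,
i.e. of `wt vᵢ` over all but the last vertex. -/
def walkWeight (H : Heap P) (vs : List ℕ) : ℕ :=
  (vs.dropLast.map H.wt).sum

/-- `pathLength H x y ∈ ℕ ∪ {∞}`: the least weight of a walk from `x` to `y`,
and `∞` if there is no walk. -/
noncomputable def pathLength (H : Heap P) (x y : ℕ) : ℕ∞ :=
  sInf {n : ℕ∞ | ∃ vs : List ℕ, H.IsWalk x y vs ∧ n = (H.walkWeight vs : ℕ∞)}

/-- `x` lies on a cycle: there is a walk from `x` to `x` with at least one step. -/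
def Circular (H : Heap P) (x : ℕ) : Prop :=
  ∃ vs : List ℕ, H.IsWalk x x vs ∧ 2 ≤ vs.length

/-- A vertex is reachable if some labelled vertex reaches it by following successors. -/
def Reachable (H : Heap P) (v : ℕ) : Prop :=
  ∃ p : P, Relation.ReflTransGen (fun a b => H.succ a = some b) (H.L p) v

/-- `H'` is obtained from `H` by a single-edge subdivision: the edge from `u`
(with `succ u = some v` and weight `n ≥ 2`) is split, for some `1 ≤ k < n`, by a
fresh vertex `q` into an edge `u → q` of weight `k` and an edge `q → v` of weight
`n - k`; everything else is unchanged. -/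
def SingleSubdiv (H H' : Heap P) : Prop :=
  ∃ u v q k : ℕ,
    u ∈ H.V ∧ H.succ u = some v ∧ 2 ≤ H.wt u ∧ 1 ≤ k ∧ k < H.wt u ∧ q ∉ H.V ∧
    H'.V = insert q H.V ∧
    H'.succ = Function.update (Function.update H.succ u (some q)) q (some v) ∧
    H'.wt = Function.update (Function.update H.wt u k) q (H.wt u - k) ∧
    H'.L = H.L

/-- `H'` is a subdivision of `H`: it is obtained from `H` by a finite (possibly
empty) sequence of single-edge subdivisions. -/
def Subdiv (H H' : Heap P) : Prop :=
  Relation.ReflTransGen SingleSubdiv H H'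

/-- Heap isomorphism: a bijection between the reachable vertices that respects
labels, successors and weights. -/
def Iso (H H' : Heap P) : Prop :=
  ∃ f : ℕ → ℕ,
    Set.BijOn f {v | H.Reachable v} {v | H'.Reachable v} ∧
    (∀ p, f (H.L p) = H'.L p) ∧
    (∀ v, H.Reachable v → H'.succ (f v) = Option.map f (H.succ v)) ∧
    (∀ v, H.Reachable v → H.succ v ≠ none → H'.wt (f v) = H.wt v)

/-- Heap homeomorphism: some subdivision of `H` is isomorphic to some
subdivision of `H'`. -/
def Homeo (H H' : Heap P) : Prop :=
  ∃ S S' : Heap P, H.Subdiv S ∧ H'.Subdiv S' ∧ Iso S S'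

end Heap

namespace Heap

variable {P : Type}

/-- `H.WalkOfWeight x y w`: there is a walk from `x` to `y` of weight `w`. -/
inductive WalkOfWeight (H : Heap P) : ℕ → ℕ → ℕ → Prop
  | refl (x : ℕ) : WalkOfWeight H x x 0
  | step {x z y w : ℕ} (hs : H.succ x = some z) (hw : WalkOfWeight H z y w) :
      WalkOfWeight H x y (H.wt x + w)

theorem mem_of_succ_eq_some {H : Heap P} {x z : ℕ} (h : H.succ x = some z) : x ∈ H.V := by
  by_contra hx
  simp [H.succ_dom x hx] at h

theorem isWalk_iff_isChain {H : Heap P} {x y : ℕ} {vs : List ℕ} :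
    H.IsWalk x y vs ↔ vs.head? = some x ∧ vs.getLast? = some y ∧
      vs.IsChain (fun a b => H.succ a = some b) :=
  Iff.rfl

theorem isWalk_singleton {H : Heap P} {x y a : ℕ} :
    H.IsWalk x y [a] ↔ a = x ∧ a = y := by
  simp [isWalk_iff_isChain]

theorem isWalk_cons_cons {H : Heap P} {x y a b : ℕ} {l : List ℕ} :
    H.IsWalk x y (a :: b :: l) ↔ a = x ∧ H.succ a = some b ∧ H.IsWalk b y (b :: l) := by
  simp [isWalk_iff_isChain]
  tauto

theorem walkWeight_cons_cons {H : Heap P} {a b : ℕ} {l : List ℕ} :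
    H.walkWeight (a :: b :: l) = H.wt a + H.walkWeight (b :: l) := by
  simp [walkWeight]

theorem IsWalk.walkOfWeight {H : Heap P} {y : ℕ} {vs : List ℕ} :
    ∀ {x : ℕ}, H.IsWalk x y vs → H.WalkOfWeight x y (H.walkWeight vs) := by
  induction vs with
  | nil => intro x h; simp [IsWalk] at h
  | cons a l ih =>
    intro x h
    cases l with
    | nil =>
      obtain ⟨rfl, rfl⟩ := isWalk_singleton.1 h
      exact .refl _
    | cons b l =>
      obtain ⟨rfl, hs, hl⟩ := isWalk_cons_cons.1 h
      rw [walkWeight_cons_cons]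
      exact .step hs (ih hl)

theorem WalkOfWeight.exists_isWalk {H : Heap P} {x y w : ℕ} (h : H.WalkOfWeight x y w) :
    ∃ vs, H.IsWalk x y vs ∧ H.walkWeight vs = w := by
  induction h with
  | refl x => exact ⟨[x], isWalk_singleton.2 ⟨rfl, rfl⟩, by simp [walkWeight]⟩
  | @step x z y w hs _ ih =>
    obtain ⟨vs, hvs, rfl⟩ := ih
    cases vs with
    | nil => simp [IsWalk] at hvs
    | cons a l =>
      obtain rfl : a = z := by simpa using hvs.1
      exact ⟨x :: a :: l, isWalk_cons_cons.2 ⟨rfl, hs, hvs⟩, walkWeight_cons_cons⟩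

theorem pathLength_eq_sInf (H : Heap P) (x y : ℕ) :
    H.pathLength x y = sInf {n : ℕ∞ | ∃ w : ℕ, H.WalkOfWeight x y w ∧ n = w} := by
  unfold pathLength
  congr 1
  ext n
  constructor
  · rintro ⟨vs, hvs, rfl⟩
    exact ⟨_, hvs.walkOfWeight, rfl⟩
  · rintro ⟨w, hw, rfl⟩
    obtain ⟨vs, hvs, rfl⟩ := hw.exists_isWalk
    exact ⟨vs, hvs, rfl⟩

theorem circular_iff (H : Heap P) (x : ℕ) :
    H.Circular x ↔ ∃ w, 0 < w ∧ H.WalkOfWeight x x w := by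
  constructor
  · rintro ⟨vs, hvs, hlen⟩
    refine ⟨_, ?_, hvs.walkOfWeight⟩
    match vs, hlen with
    | a :: b :: l, _ =>
      obtain ⟨rfl, hs, -⟩ := isWalk_cons_cons.1 hvs
      have := H.wt_pos a (mem_of_succ_eq_some hs) (by simp [hs])
      rw [walkWeight_cons_cons]
      omega
  · rintro ⟨w, hpos, hw⟩
    obtain ⟨vs, hvs, rfl⟩ := hw.exists_isWalk
    refine ⟨vs, hvs, ?_⟩
    match vs, hpos with
    | a :: b :: l, _ => simp

theorem SingleSubdiv.walkOfWeight_iff {H H' : Heap P} (h : H.SingleSubdiv H') {x y w : ℕ}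
    (hx : x ∈ H.V) (hy : y ∈ H.V) : H.WalkOfWeight x y w ↔ H'.WalkOfWeight x y w := by
  obtain ⟨u, v, q, k, hu, huv, -, -, hk, hq, -, hsucc, hwt, -⟩ := h
  have huq : u ≠ q := fun e => hq (e ▸ hu)
  have succ_u : H'.succ u = some q := by simp [hsucc, huq]
  have succ_q : H'.succ q = some v := by simp [hsucc]
  have wt_u : H'.wt u = k := by simp [hwt, huq]
  have wt_q : H'.wt q = H.wt u - k := by simp [hwt]
  have succ_ne {a : ℕ} (hau : a ≠ u) (haq : a ≠ q) : H'.succ a = H.succ a := by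
    simp [hsucc, hau, haq]
  have wt_ne {a : ℕ} (hau : a ≠ u) (haq : a ≠ q) : H'.wt a = H.wt a := by
    simp [hwt, hau, haq]
  constructor
  · intro hw
    clear hx hy
    induction hw with
    | refl x => exact .refl x
    | @step x z y w hs _ ih =>
      have hxq : x ≠ q := fun e => hq (e ▸ mem_of_succ_eq_some hs)
      by_cases hxu : x = u
      · subst hxu
        obtain rfl : v = z := by simpa [huv] using hs
        have := WalkOfWeight.step succ_u (.step succ_q ih)
        rwa [wt_u, wt_q, ← add_assoc, Nat.add_sub_cancel' hk.le] at this
      · rw [← wt_ne hxu hxq]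
        exact .step ((succ_ne hxu hxq).trans hs) ih
  · intro hw
    suffices (x ∈ H.V → H.WalkOfWeight x y w) ∧
        (x = q → ∃ w', w = H.wt u - k + w' ∧ H.WalkOfWeight v y w') from this.1 hx
    clear hx
    induction hw with
    | refl x => exact ⟨fun _ => .refl x, fun e => absurd (e ▸ hy) hq⟩
    | @step x z y w hs _ ih =>
      obtain ⟨ih_mem, ih_q⟩ := ih hy
      constructor
      · intro hx
        have hxq : x ≠ q := fun e => hq (e ▸ hx)
        by_cases hxu : x = u
        · subst hxu
          obtain ⟨w', rfl, hw'⟩ := ih_q (by simpa [succ_u, eq_comm] using hs)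
          rw [wt_u, ← add_assoc, Nat.add_sub_cancel' hk.le]
          exact .step huv hw'
        · rw [succ_ne hxu hxq] at hs
          rw [wt_ne hxu hxq]
          exact .step hs (ih_mem (H.succ_mem x hx z hs))
      · rintro rfl
        obtain rfl : v = z := by simpa [succ_q] using hs
        exact ⟨w, by rw [wt_q], ih_mem (H.succ_mem u hu v huv)⟩

theorem SingleSubdiv.subset {H H' : Heap P} (h : H.SingleSubdiv H') : H.V ⊆ H'.V := by
  obtain ⟨u, v, q, k, -, -, -, -, -, -, hV, -⟩ := h
  exact hV ▸ Finset.subset_insert q H.V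

theorem Subdiv.subset {H H' : Heap P} (h : H.Subdiv H') : H.V ⊆ H'.V := by
  induction h with
  | refl => exact subset_rfl
  | tail _ h ih => exact ih.trans h.subset

theorem Subdiv.walkOfWeight_iff {H H' : Heap P} (h : H.Subdiv H') {x y w : ℕ}
    (hx : x ∈ H.V) (hy : y ∈ H.V) : H.WalkOfWeight x y w ↔ H'.WalkOfWeight x y w := by
  induction h with
  | refl => rfl
  | tail hs h ih =>
    exact ih.trans (h.walkOfWeight_iff (Subdiv.subset hs hx) (Subdiv.subset hs hy))

end Heap

/-- Subdivision (a finite sequence of single-edge subdivisions) preserves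
observations: path lengths between vertices of the original heap, and
circularity. -/
theorem subdiv_preserves_observations {P : Type} (H H' : Heap P)
    (h : H.Subdiv H') :
    (∀ x ∈ H.V, ∀ y ∈ H.V, H.pathLength x y = H'.pathLength x y) ∧
    (∀ x ∈ H.V, (H.Circular x ↔ H'.Circular x)) := by
  refine ⟨fun x hx y hy => ?_, fun x hx => ?_⟩
  · simp only [Heap.pathLength_eq_sInf, h.walkOfWeight_iff hx hy]
  · simp only [Heap.circular_iff, h.walkOfWeight_iff hx hx]
end

section
/- Every heap H over P has a subdivision Sh(H) in which every edge has weight 1 (i.e. wt v = 1 for every vertex v with succ v ≠ none). Moreover, any two subdivisions of H in which every edge has weight 1 are isomorphic. -/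
/-- Every edge of `S` has weight 1. -/
def Heap.UnitWeights {P : Type} (S : Heap P) : Prop :=
  ∀ v ∈ S.V, S.succ v ≠ none → S.wt v = 1

namespace Heap

variable {P : Type}

/-- The points of the unit-step refinement of `H`: `(v, i)` is the point at distance `i`
from `v` along the edge leaving `v`. -/
def IsPoint (H : Heap P) (x : ℕ × ℕ) : Prop :=
  x.1 ∈ H.V ∧ (x.2 = 0 ∨ x.2 < H.wt x.1)

/-- Advance a point by one unit of weight. -/
def step (H : Heap P) (x : ℕ × ℕ) : Option (ℕ × ℕ) :=
  (H.succ x.1).map fun u => if x.2 + 1 < H.wt x.1 then (x.1, x.2 + 1) else (u, 0)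

/-- An injective map from the points of `S` to the points of `H` that respects labels and
unit steps. -/
structure IsPointEmbedding (S H : Heap P) (g : ℕ × ℕ → ℕ × ℕ) : Prop where
  injOn : Set.InjOn g {x | S.IsPoint x}
  mapsTo : ∀ x, S.IsPoint x → H.IsPoint (g x)
  label : ∀ p, g (S.L p, 0) = (H.L p, 0)
  step_eq : ∀ x, S.IsPoint x → H.step (g x) = (S.step x).map g

theorem IsPointEmbedding.comp {S T H : Heap P} {g g' : ℕ × ℕ → ℕ × ℕ}
    (hg : IsPointEmbedding T H g) (hg' : IsPointEmbedding S T g') :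
    IsPointEmbedding S H (g ∘ g') where
  injOn := hg.injOn.comp hg'.injOn hg'.mapsTo
  mapsTo x hx := hg.mapsTo _ (hg'.mapsTo x hx)
  label p := by simp [hg'.label, hg.label]
  step_eq x hx := by
    simp [hg.step_eq _ (hg'.mapsTo x hx), hg'.step_eq x hx]

theorem SingleSubdiv.exists_isPointEmbedding {H S : Heap P} (h : SingleSubdiv H S) :
    ∃ g, IsPointEmbedding S H g := by
  obtain ⟨u, v, q, k, hu, huv, hn, hk, hkn, hq, hV, hsucc, hwt, hL⟩ := h
  have hqu : u ≠ q := fun h => hq (h ▸ hu)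
  refine ⟨fun x => if x.1 = q then (u, x.2 + k) else x, ?_, ?_, ?_, ?_⟩
  · rintro ⟨a, i⟩ ha ⟨b, j⟩ hb hab
    simp only [IsPoint, Set.mem_ofPred_eq, hV, hwt, Finset.mem_insert,
      Function.update_apply] at ha hb hab
    grind
  · rintro ⟨a, i⟩ ha
    simp only [IsPoint, hV, hwt, Finset.mem_insert, Function.update_apply] at ha ⊢
    grind
  · intro p
    have := H.label_mem p
    grind
  · rintro ⟨a, i⟩ ha
    have hmem := H.succ_mem
    simp only [IsPoint, step, hV, hwt, hsucc, Finset.mem_insert,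
      Function.update_apply] at ha ⊢
    by_cases haq : a = q
    · grind
    · by_cases hau : a = u
      · grind
      · cases hs : H.succ a with
        | none => grind
        | some w =>
          have := hmem a (by grind) w hs
          grind

theorem Subdiv.exists_isPointEmbedding {H S : Heap P} (h : H.Subdiv S) :
    ∃ g, IsPointEmbedding S H g := by
  induction h with
  | refl => exact ⟨id, Function.injective_id.injOn, fun _ h => h, fun _ => rfl, by simp⟩
  | tail _ hs ih =>
    obtain ⟨g, hg⟩ := ih
    obtain ⟨g', hg'⟩ := hs.exists_isPointEmbedding
    exact ⟨_, hg.comp hg'⟩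

/-- An injective map from the vertices of `S` to the points of `H` that respects labels and
turns each edge of `S` into a single unit step of `H`. -/
structure IsUnitEmbedding (S H : Heap P) (e : ℕ → ℕ × ℕ) : Prop where
  injOn : Set.InjOn e {v | v ∈ S.V}
  label : ∀ p, e (S.L p) = (H.L p, 0)
  step_eq : ∀ v ∈ S.V, H.step (e v) = (S.succ v).map e

theorem Subdiv.exists_isUnitEmbedding {H S : Heap P} (h : H.Subdiv S) (hS : S.UnitWeights) :
    ∃ e, IsUnitEmbedding S H e := by
  obtain ⟨g, hg⟩ := h.exists_isPointEmbedding
  have hpt : ∀ v ∈ S.V, S.IsPoint (v, 0) := fun v hv => ⟨hv, Or.inl rfl⟩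
  refine ⟨fun v => g (v, 0), ?_, hg.label, ?_⟩
  · intro v hv w hw hvw
    exact congrArg Prod.fst (hg.injOn (hpt v hv) (hpt w hw) hvw)
  · intro v hv
    rw [hg.step_eq _ (hpt v hv), step]
    cases hs : S.succ v with
    | none => simp
    | some u => simp [hS v hv (by simp [hs])]

theorem Reachable.mem {H : Heap P} {v : ℕ} (h : H.Reachable v) : v ∈ H.V := by
  obtain ⟨p, hp⟩ := h
  induction hp with
  | refl => exact H.label_mem p
  | tail _ hs ih => exact H.succ_mem _ ih _ hs

theorem Reachable.succ {H : Heap P} {v u : ℕ} (h : H.Reachable v) (hs : H.succ v = some u) :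
    H.Reachable u :=
  let ⟨p, hp⟩ := h
  ⟨p, hp.tail hs⟩

theorem IsUnitEmbedding.exists_reachable_eq {S₁ S₂ H : Heap P} {e₁ e₂ : ℕ → ℕ × ℕ}
    (h₁ : IsUnitEmbedding S₁ H e₁) (h₂ : IsUnitEmbedding S₂ H e₂) {v : ℕ}
    (hv : S₁.Reachable v) : ∃ w, S₂.Reachable w ∧ e₂ w = e₁ v := by
  obtain ⟨p, hp⟩ := hv
  induction hp with
  | refl => exact ⟨S₂.L p, ⟨p, .refl⟩, by rw [h₁.label, h₂.label]⟩
  | @tail a b ha hab ih =>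
    obtain ⟨w, hw, hwa⟩ := ih
    have h := h₂.step_eq w hw.mem
    rw [hwa, h₁.step_eq a (Reachable.mem ⟨p, ha⟩), hab, Option.map_some, eq_comm,
      Option.map_eq_some_iff] at h
    obtain ⟨w', hw', he⟩ := h
    exact ⟨w', hw.succ hw', he⟩

theorem IsUnitEmbedding.iso {S₁ S₂ H : Heap P} {e₁ e₂ : ℕ → ℕ × ℕ}
    (h₁ : IsUnitEmbedding S₁ H e₁) (h₂ : IsUnitEmbedding S₂ H e₂)
    (hS₁ : S₁.UnitWeights) (hS₂ : S₂.UnitWeights) : Iso S₁ S₂ := by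
  choose! f hfr hfe using fun v (hv : S₁.Reachable v) => h₁.exists_reachable_eq h₂ hv
  have hsucc : ∀ v, S₁.Reachable v → S₂.succ (f v) = Option.map f (S₁.succ v) := by
    intro v hv
    have h := h₂.step_eq (f v) (hfr v hv).mem
    rw [hfe v hv, h₁.step_eq v hv.mem] at h
    cases hs₁ : S₁.succ v with
    | none => simpa [hs₁, eq_comm] using h
    | some a =>
      have ha := hv.succ hs₁
      cases hs₂ : S₂.succ (f v) with
      | none => simp [hs₁, hs₂] at h
      | some b =>
        simp only [hs₁, hs₂, Option.map_some, Option.some.injEq] at h ⊢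
        exact h₂.injOn ((hfr v hv).succ hs₂).mem (hfr a ha).mem (h.symm.trans (hfe a ha).symm)
  refine ⟨f, ⟨hfr, ?_, ?_⟩, ?_, hsucc, ?_⟩
  · intro v hv w hw hvw
    exact h₁.injOn hv.mem hw.mem (by rw [← hfe v hv, ← hfe w hw, hvw])
  · intro w hw
    obtain ⟨v, hv, hvw⟩ := h₂.exists_reachable_eq h₁ hw
    exact ⟨v, hv, h₂.injOn (hfr v hv).mem hw.mem ((hfe v hv).trans hvw)⟩
  · intro p
    have hp : S₁.Reachable (S₁.L p) := ⟨p, .refl⟩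
    exact h₂.injOn (hfr _ hp).mem (S₂.label_mem p) (by rw [hfe _ hp, h₁.label, h₂.label])
  · intro v hv hs
    rw [hS₁ v hv.mem hs, hS₂ (f v) (hfr v hv).mem (by simpa [hsucc v hv] using hs)]

/-- The total weight of `H` in excess of unit weights. -/
def excess (H : Heap P) : ℕ :=
  ∑ v ∈ H.V, if H.succ v = none then 0 else H.wt v - 1

theorem exists_singleSubdiv_excess_lt {H : Heap P} (h : ¬ H.UnitWeights) :
    ∃ S, SingleSubdiv H S ∧ S.excess < H.excess := by
  simp only [UnitWeights, not_forall] at h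
  obtain ⟨u, hu, hs, hne⟩ := h
  have hn : 2 ≤ H.wt u := by have := H.wt_pos u hu hs; omega
  obtain ⟨v, hv⟩ := Option.ne_none_iff_exists'.mp hs
  obtain ⟨q, hq⟩ := Infinite.exists_notMem_finset H.V
  have huq : u ≠ q := fun h => hq (h ▸ hu)
  refine ⟨{
    V := insert q H.V
    succ := Function.update (Function.update H.succ u (some q)) q (some v)
    wt := Function.update (Function.update H.wt u 1) q (H.wt u - 1)
    L := H.L
    label_mem := fun p => Finset.mem_insert_of_mem (H.label_mem p)
    succ_mem := ?_
    succ_dom := ?_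
    wt_pos := ?_ }, ⟨u, v, q, 1, hu, hv, hn, le_rfl, hn, hq, rfl, rfl, rfl, rfl⟩, ?_⟩
  · intro a ha b hab
    have := H.succ_mem
    simp only [Function.update_apply, Finset.mem_insert] at *
    grind
  · intro a ha
    have := H.succ_dom a
    simp only [Function.update_apply, Finset.mem_insert] at *
    grind
  · intro a ha hab
    have := H.wt_pos a
    simp only [Function.update_apply, Finset.mem_insert] at *
    grind
  · simp only [excess]
    rw [Finset.sum_insert hq, ← Finset.add_sum_erase _ _ hu, ← Finset.add_sum_erase H.V _ hu]
    have hrest : ∀ a ∈ H.V.erase u, a ≠ q ∧ a ≠ u := by grind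
    rw [Finset.sum_congr rfl fun a ha => by
      rw [Function.update_of_ne (hrest a ha).1, Function.update_of_ne (hrest a ha).2,
        Function.update_of_ne (hrest a ha).1, Function.update_of_ne (hrest a ha).2]]
    simp [huq, hv]
    omega

theorem exists_subdiv_unitWeights (H : Heap P) : ∃ S, H.Subdiv S ∧ S.UnitWeights := by
  induction hm : H.excess using Nat.strong_induction_on generalizing H with
  | _ m ih =>
    by_cases h : H.UnitWeights
    · exact ⟨H, .refl, h⟩
    · obtain ⟨T, hT, hlt⟩ := exists_singleSubdiv_excess_lt h
      obtain ⟨S, hS, hu⟩ := ih _ (hm ▸ hlt) T rfl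
      exact ⟨S, .head hT hS, hu⟩

end Heap

/-- Shells exist and are unique up to isomorphism: every heap has a subdivision
in which every edge has weight 1, and any two such subdivisions are isomorphic. -/
theorem shell_exists_unique {P : Type} (H : Heap P) :
    (∃ S : Heap P, H.Subdiv S ∧ S.UnitWeights) ∧
    (∀ S₁ S₂ : Heap P, H.Subdiv S₁ → H.Subdiv S₂ →
      S₁.UnitWeights → S₂.UnitWeights → Heap.Iso S₁ S₂) := by
  refine ⟨H.exists_subdiv_unitWeights, fun S₁ S₂ h₁ h₂ hS₁ hS₂ => ?_⟩
  obtain ⟨e₁, he₁⟩ := h₁.exists_isUnitEmbedding hS₁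
  obtain ⟨e₂, he₂⟩ := h₂.exists_isUnitEmbedding hS₂
  exact he₁.iso he₂ hS₁ hS₂
end
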